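/- Let M ≥ 1 and K ≥ 0 be integers and c_1, …, c_{K+1} > 0 real constants. For γ̄ > 0 and each k, define ε_k(γ̄) = ξ√β · ∫_{φ_L}^{φ_H} (1 − e^{−γ/(c_k γ̄)})^M dγ, and let E_e2e(γ̄) = 1 − ∏_{k=1}^{K+1} (1 − ε_k(γ̄)). Then lim_{γ̄ → ∞} ( − log E_e2e(γ̄) / log γ̄ ) = M, i.e., the end-to-end diversity order of the multihop TAS/SC relay chain equals M = N_T·N_R regardless of the number of hops. -/

import Mathlib

open Filter Topology

/-- A function squeezed between positive multiples of `x ^ (-M)` has logarithmic decay rate `M`. -/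
theorem tendsto_neg_log_div_log_of_bounds {f : ℝ → ℝ} {M : ℕ} {A B : ℝ} (hA : 0 < A)
    (hlow : ∀ᶠ x in atTop, A * (x ^ M)⁻¹ ≤ f x)
    (hupp : ∀ᶠ x in atTop, f x ≤ B * (x ^ M)⁻¹) :
    Tendsto (fun x => -Real.log (f x) / Real.log x) atTop (𝓝 (M : ℝ)) := by
  have hlim : ∀ C : ℝ, Tendsto (fun x => (M : ℝ) - Real.log C / Real.log x) atTop (𝓝 (M : ℝ)) := by
    intro C
    simpa using (tendsto_const_nhds (x := (M : ℝ))).sub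
      (tendsto_const_nhds.div_atTop Real.tendsto_log_atTop)
  have hlog : ∀ C x : ℝ, 0 < C → 1 < x →
      Real.log (C * (x ^ M)⁻¹) = Real.log C - M * Real.log x := by
    intro C x hC hx
    have hx0 : 0 < x := by linarith
    rw [Real.log_mul hC.ne' (by positivity), Real.log_inv, Real.log_pow]
    ring
  refine tendsto_of_tendsto_of_tendsto_of_le_of_le' (hlim B) (hlim A) ?_ ?_
  · filter_upwards [hlow, hupp, eventually_gt_atTop 1] with x h₁ h₂ hx
    have hx0 : 0 < x := by linarith
    have hpos : 0 < A * (x ^ M)⁻¹ := by positivity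
    have hB : 0 < B := by
      refine pos_of_mul_pos_left (b := (x ^ M)⁻¹) (by linarith) (by positivity)
    have hl := Real.log_pos hx
    have h := Real.log_le_log (hpos.trans_le h₁) h₂
    rw [hlog B x hB hx] at h
    rw [le_div_iff₀ hl, sub_mul, div_mul_cancel₀ _ hl.ne']
    linarith
  · filter_upwards [hlow, eventually_gt_atTop 1] with x h₁ hx
    have hx0 : 0 < x := by linarith
    have hpos : 0 < A * (x ^ M)⁻¹ := by positivity
    have hl := Real.log_pos hx
    have h := Real.log_le_log hpos h₁
    rw [hlog A x hA hx] at h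
    rw [div_le_iff₀ hl, sub_mul, div_mul_cancel₀ _ hl.ne']
    linarith

theorem one_sub_exp_neg_le (x : ℝ) : 1 - Real.exp (-x) ≤ x := by
  linarith [Real.add_one_le_exp (-x)]

theorem div_two_le_one_sub_exp_neg {x : ℝ} (hx0 : 0 ≤ x) (hx1 : x ≤ 1) :
    x / 2 ≤ 1 - Real.exp (-x) := by
  have h : Real.exp (-x) ≤ (1 + x)⁻¹ := by
    rw [Real.exp_neg]
    exact inv_anti₀ (by linarith) (by linarith [Real.add_one_le_exp x])
  have h' : (1 + x)⁻¹ ≤ 1 - x / 2 := by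
    rw [inv_le_iff_one_le_mul₀ (by linarith)]
    nlinarith
  linarith

/-- Two-sided bounds for the integrated outage probability of selection diversity of order `M`. -/
theorem integral_one_sub_exp_pow_bounds {a b c x : ℝ} (ha : 0 ≤ a) (hab : a ≤ b) (hc : 0 < c)
    (hx : 0 < x) (hbx : b ≤ c * x) (M : ℕ) :
    (∫ γ in a..b, γ ^ M) * ((2 * c) ^ M)⁻¹ * (x ^ M)⁻¹ ≤
        ∫ γ in a..b, (1 - Real.exp (-γ / (c * x))) ^ M ∧
      ∫ γ in a..b, (1 - Real.exp (-γ / (c * x))) ^ M ≤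
        (∫ γ in a..b, γ ^ M) * (c ^ M)⁻¹ * (x ^ M)⁻¹ := by
  have hcx : 0 < c * x := by positivity
  have hint : IntervalIntegrable (fun γ => (1 - Real.exp (-γ / (c * x))) ^ M)
      MeasureTheory.volume a b := by
    apply Continuous.intervalIntegrable
    fun_prop
  have hpow : ∀ d : ℝ, IntervalIntegrable (fun γ : ℝ => γ ^ M * (d ^ M)⁻¹ * (x ^ M)⁻¹)
      MeasureTheory.volume a b := by
    intro d
    apply Continuous.intervalIntegrable
    fun_prop
  have hscale : ∀ d γ : ℝ, γ ^ M * (d ^ M)⁻¹ * (x ^ M)⁻¹ = (γ / (d * x)) ^ M := by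
    intro d γ
    rw [div_pow, mul_pow, div_eq_mul_inv, mul_inv, mul_assoc]
  simp only [← intervalIntegral.integral_mul_const]
  constructor
  · refine intervalIntegral.integral_mono_on hab (hpow _) hint fun γ hγ => ?_
    have hγ0 : 0 ≤ γ := ha.trans hγ.1
    have h := div_two_le_one_sub_exp_neg (x := γ / (c * x)) (by positivity)
      ((div_le_one hcx).2 (hγ.2.trans hbx))
    rw [hscale, neg_div]
    refine pow_le_pow_left₀ (by positivity) (le_trans (le_of_eq ?_) h) M
    field_simp
  · refine intervalIntegral.integral_mono_on hab hint (hpow _) fun γ hγ => ?_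
    have hγ0 : 0 ≤ γ := ha.trans hγ.1
    have h0 : 0 ≤ γ / (c * x) := by positivity
    rw [hscale, neg_div]
    refine pow_le_pow_left₀ ?_ (one_sub_exp_neg_le _) M
    linarith [Real.exp_le_one_iff.2 (neg_nonpos.2 h0)]

theorem one_sub_prod_one_sub_le_sum {ι : Type*} (s : Finset ι) (f : ι → ℝ)
    (h0 : ∀ i ∈ s, 0 ≤ f i) (h1 : ∀ i ∈ s, f i ≤ 1) :
    1 - ∏ i ∈ s, (1 - f i) ≤ ∑ i ∈ s, f i := by
  classical
  induction s using Finset.induction_on with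
  | empty => simp
  | insert j s hj ih =>
    rw [Finset.prod_insert hj, Finset.sum_insert hj]
    have hs := ih (fun i hi => h0 i (Finset.mem_insert_of_mem hi))
      (fun i hi => h1 i (Finset.mem_insert_of_mem hi))
    have hp : ∏ i ∈ s, (1 - f i) ≤ 1 := Finset.prod_le_one
      (fun i hi => by linarith [h1 i (Finset.mem_insert_of_mem hi)])
      (fun i hi => by linarith [h0 i (Finset.mem_insert_of_mem hi)])
    nlinarith [h0 j (Finset.mem_insert_self j s)]

theorem le_one_sub_prod_one_sub {ι : Type*} {s : Finset ι} {f : ι → ℝ}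
    (h0 : ∀ i ∈ s, 0 ≤ f i) (h1 : ∀ i ∈ s, f i ≤ 1) {j : ι} (hj : j ∈ s) :
    f j ≤ 1 - ∏ i ∈ s, (1 - f i) := by
  classical
  rw [← Finset.mul_prod_erase s _ hj]
  have hp : ∏ i ∈ s.erase j, (1 - f i) ≤ 1 := Finset.prod_le_one
    (fun i hi => by linarith [h1 i (Finset.mem_of_mem_erase hi)])
    (fun i hi => by linarith [h0 i (Finset.mem_of_mem_erase hi)])
  nlinarith [h1 j hj]

/-- **End-to-end diversity order of the multihop TAS/SC relay chain.**
With per-hop BLERs `ε_k(γ̄) = ξ√β ∫_{φ_L}^{φ_H} (1 - e^{-γ/(c_k γ̄)})^M dγ` and end-to-end BLER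
`E_e2e(γ̄) = 1 - ∏_k (1 - ε_k(γ̄))`, one has `- log E_e2e(γ̄) / log γ̄ → M` as `γ̄ → ∞`,
regardless of the number of hops. -/
theorem e2e_diversity_order_tas_sc
    (R β ξ τ φH φL : ℝ) (hR : 0 < R) (hβ : 0 < β)
    (hξ : ξ = (2 * Real.pi * ((2 : ℝ) ^ (2 * R) - 1)) ^ (-(1 / 2) : ℝ))
    (hτ : τ = (2 : ℝ) ^ R - 1)
    (hφH : φH = τ + 1 / (2 * ξ * Real.sqrt β))
    (hφL : φL = τ - 1 / (2 * ξ * Real.sqrt β))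
    (hφL0 : 0 ≤ φL)
    (M : ℕ) (hM : 1 ≤ M) (K : ℕ)
    (c : Fin (K + 1) → ℝ) (hc : ∀ k, 0 < c k)
    (ε : Fin (K + 1) → ℝ → ℝ)
    (hε : ∀ k, ∀ γbar : ℝ, 0 < γbar →
      ε k γbar = ξ * Real.sqrt β * ∫ γ in φL..φH, (1 - Real.exp (-γ / (c k * γbar))) ^ M)
    (Ee2e : ℝ → ℝ)
    (hE : ∀ γbar : ℝ, Ee2e γbar = 1 - ∏ k, (1 - ε k γbar)) :
    Tendsto (fun γbar : ℝ => -Real.log (Ee2e γbar) / Real.log γbar) atTop (𝓝 (M : ℝ)) := by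
  have hξ0 : 0 < ξ := by
    have h2 : (1 : ℝ) < 2 ^ (2 * R) := Real.one_lt_rpow (by norm_num) (by linarith)
    rw [hξ]
    exact Real.rpow_pos_of_pos (mul_pos (by positivity) (by linarith)) _
  have hs : 0 < ξ * Real.sqrt β := mul_pos hξ0 (Real.sqrt_pos.2 hβ)
  have hlt : φL < φH := by
    have h : 0 < 1 / (2 * ξ * Real.sqrt β) := by
      rw [mul_assoc]
      positivity
    linarith
  set I : ℝ := ∫ γ in φL..φH, γ ^ M
  have hI0 : 0 < I := by
    refine intervalIntegral.intervalIntegral_pos_of_pos_on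
      ((continuous_pow M).intervalIntegrable _ _) (fun γ hγ => ?_) hlt
    exact pow_pos (hφL0.trans_lt hγ.1) M
  have hlow : ∀ k, ∀ᶠ x in atTop,
      ξ * Real.sqrt β * I * ((2 * c k) ^ M)⁻¹ * (x ^ M)⁻¹ ≤ ε k x := by
    intro k
    filter_upwards [eventually_gt_atTop 0, eventually_ge_atTop (φH / c k)] with x hx hxk
    have h := (integral_one_sub_exp_pow_bounds hφL0 hlt.le (hc k) hx
      ((div_le_iff₀' (hc k)).1 hxk) M).1
    rw [hε k x hx]
    simpa only [mul_assoc] using mul_le_mul_of_nonneg_left h hs.le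
  have hupp : ∀ k, ∀ᶠ x in atTop,
      ε k x ≤ ξ * Real.sqrt β * I * (c k ^ M)⁻¹ * (x ^ M)⁻¹ := by
    intro k
    filter_upwards [eventually_gt_atTop 0, eventually_ge_atTop (φH / c k)] with x hx hxk
    have h := (integral_one_sub_exp_pow_bounds hφL0 hlt.le (hc k) hx
      ((div_le_iff₀' (hc k)).1 hxk) M).2
    rw [hε k x hx]
    simpa only [mul_assoc] using mul_le_mul_of_nonneg_left h hs.le
  have hnonneg : ∀ k, ∀ᶠ x in atTop, 0 ≤ ε k x := by
    intro k
    filter_upwards [hlow k, eventually_gt_atTop 0] with x h hx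
    have hck := hc k
    exact le_trans (by positivity) h
  have hle_one : ∀ k, ∀ᶠ x in atTop, ε k x ≤ 1 := by
    intro k
    have hlim : Tendsto (fun x : ℝ => ξ * Real.sqrt β * I * (c k ^ M)⁻¹ * (x ^ M)⁻¹)
        atTop (𝓝 0) := by
      simpa using (tendsto_pow_atTop (by omega : M ≠ 0)).inv_tendsto_atTop.const_mul
        (ξ * Real.sqrt β * I * (c k ^ M)⁻¹)
    filter_upwards [hupp k, hlim.eventually_le_const one_pos] with x h h'
    exact h.trans h'
  have hck := hc 0
  refine tendsto_neg_log_div_log_of_bounds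
    (A := ξ * Real.sqrt β * I * ((2 * c 0) ^ M)⁻¹)
    (B := ∑ k, ξ * Real.sqrt β * I * (c k ^ M)⁻¹) (by positivity) ?_ ?_
  · filter_upwards [hlow 0, eventually_all.2 hnonneg, eventually_all.2 hle_one] with x h h0 h1
    rw [hE]
    exact h.trans (le_one_sub_prod_one_sub (f := fun k => ε k x)
      (fun i _ => h0 i) (fun i _ => h1 i) (Finset.mem_univ 0))
  · filter_upwards [eventually_all.2 hupp, eventually_all.2 hnonneg, eventually_all.2 hle_one]
      with x h h0 h1
    rw [hE, Finset.sum_mul]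
    exact (one_sub_prod_one_sub_le_sum _ (fun k => ε k x)
      (fun i _ => h0 i) (fun i _ => h1 i)).trans (Finset.sum_le_sum fun k _ => h k)
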